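/- Fix n ≥ 1 and let σ : U → U be a ring homomorphism such that σ(E_j) = E_j for all j = 1, …, n and σ(c·1) = c̄·1 for every scalar c ∈ K, where c ↦ c̄ is the ℚ-algebra automorphism of K = ℚ(v) determined by v ↦ v^{−1}. Let x = (x_1, …, x_{n−1}) be a tuple of nonnegative integers with x_k ≤ min(k, n−k) for all k. Then σ( E(x') ) = Σ_y w_y · E(y'), where the sum ranges over all tuples y = (y_1, …, y_{n−1}) of nonnegative integers with y_k ≤ x_k for all k, and, writing d_k = x_k − y_k (with conventions x_0 = x_n = y_0 = y_n = d_0 = d_n = 0) and a_k = n + 1 − x_{k−1} − x_k, the coefficient is w_y = v^{ − Σ_{k=1}^{n−1} d_k(d_k−1)/2 } · (v^{−1} − v)^{ Σ_{k=1}^{n−1} d_k } · ( Π_{k=1}^{n−1} [d_k]_v! ) · Π_{k=1}^{n} binom( a_k + d_k + d_{k−1} , d_k )_v · binom( a_k + d_{k−1} , d_{k−1} )_v. -/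

import Mathlib

noncomputable section

/-- The base field `K = ℚ(v)`. -/
abbrev K : Type := RatFunc ℚ

/-- The variable `v ∈ ℚ(v)`. -/
noncomputable def v : K := RatFunc.X

/-- The quantum integer `[k]_v = (v^k - v^{-k})/(v - v^{-1})`. -/
noncomputable def qint (k : ℕ) : K := (v ^ k - v⁻¹ ^ k) / (v - v⁻¹)

/-- The quantum factorial `[k]_v!`. -/
noncomputable def qfact : ℕ → K
  | 0 => 1
  | k + 1 => qint (k + 1) * qfact k

/-- The quantum binomial coefficient `binom(k, m)_v`. -/
noncomputable def qbinom (k m : ℕ) : K := qfact k / (qfact m * qfact (k - m))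

/-- The defining relations of `U_v^+(sl_{n+1})`: commutation for distant indices
and the quantum Serre relations for adjacent indices. -/
inductive SerreRel (n : ℕ) : FreeAlgebra K (Fin n) → FreeAlgebra K (Fin n) → Prop
  | comm (i j : Fin n) (h : (i : ℕ) + 1 < (j : ℕ)) :
      SerreRel n (FreeAlgebra.ι K i * FreeAlgebra.ι K j) (FreeAlgebra.ι K j * FreeAlgebra.ι K i)
  | serre (i j : Fin n) (h : (i : ℕ) + 1 = (j : ℕ) ∨ (j : ℕ) + 1 = (i : ℕ)) :
      SerreRel n (FreeAlgebra.ι K i ^ 2 * FreeAlgebra.ι K j + FreeAlgebra.ι K j * FreeAlgebra.ι K i ^ 2)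
        ((v + v⁻¹) • (FreeAlgebra.ι K i * FreeAlgebra.ι K j * FreeAlgebra.ι K i))

/-- The algebra `U = U_v^+(sl_{n+1})`, presented by generators `E_1, …, E_n` and the
quantum Serre relations. -/
abbrev Uq (n : ℕ) := RingQuot (SerreRel n)

/-- The Chevalley generator `E_i ∈ U` for `1 ≤ i ≤ n` (junk value `0` outside this range). -/
noncomputable def E (n : ℕ) (i : ℕ) : Uq n :=
  if h : i - 1 < n ∧ 1 ≤ i then
    RingQuot.mkAlgHom K (SerreRel n) (FreeAlgebra.ι K (⟨i - 1, h.1⟩ : Fin n)) else 0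

/-- The divided power `u^{(r)} = u^r / [r]_v!`. -/
noncomputable def dp (n : ℕ) (u : Uq n) (r : ℕ) : Uq n := (qfact r)⁻¹ • u ^ r

/-- The root vector `E_{i,i+1} = E_{i+1}E_i - v^{-1}E_iE_{i+1}`. -/
noncomputable def Ebr (n : ℕ) (i : ℕ) : Uq n :=
  E n (i + 1) * E n i - v⁻¹ • (E n i * E n (i + 1))

/-- The ordered product `g 1 * g 2 * ⋯ * g n` in `U`. -/
noncomputable def Eprod (n : ℕ) (g : ℕ → Uq n) : Uq n :=
  ((List.range n).map fun k => g (k + 1)).prod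

/-- Extension of a tuple `(x_1, …, x_{n-1})` (given as a function on `Fin (n-1)`)
to a function on `ℕ`, with the convention `x_k = 0` for `k = 0` and `k ≥ n`. -/
def tup (n : ℕ) (x : Fin (n - 1) → ℕ) (k : ℕ) : ℕ :=
  if h : k - 1 < n - 1 ∧ 1 ≤ k then x ⟨k - 1, h.1⟩ else 0


theorem v_ne_zero : v ≠ 0 := RatFunc.X_ne_zero

theorem v_pow_ne_one {k : ℕ} (hk : k ≠ 0) : v ^ k ≠ 1 := by
  intro h
  have h' : algebraMap (Polynomial ℚ) (RatFunc ℚ) (Polynomial.X ^ k) =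
      algebraMap (Polynomial ℚ) (RatFunc ℚ) 1 := by
    rw [map_pow, RatFunc.algebraMap_X, map_one]
    exact h
  have hX := congrArg Polynomial.natDegree (RatFunc.algebraMap_injective ℚ h')
  rw [Polynomial.natDegree_X_pow, Polynomial.natDegree_one] at hX
  exact hk hX

theorem v_pow_sub_inv_pow_ne_zero {k : ℕ} (hk : k ≠ 0) : v ^ k - v⁻¹ ^ k ≠ 0 := by
  intro h
  have hv : v ^ k ≠ 0 := pow_ne_zero k v_ne_zero
  apply v_pow_ne_one (k := k + k) (by omega)
  rw [pow_add]
  nth_rewrite 2 [sub_eq_zero.mp h]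
  rw [inv_pow, mul_inv_cancel₀ hv]

theorem v_sub_inv_ne_zero : v - v⁻¹ ≠ 0 := by
  simpa using v_pow_sub_inv_pow_ne_zero one_ne_zero

theorem qint_zero : qint 0 = 0 := by simp [qint]

theorem qint_one : qint 1 = 1 := by
  simpa [qint] using div_self v_sub_inv_ne_zero

theorem qint_ne_zero {k : ℕ} (hk : k ≠ 0) : qint k ≠ 0 :=
  div_ne_zero (v_pow_sub_inv_pow_ne_zero hk) v_sub_inv_ne_zero

theorem qint_add (d m : ℕ) : qint (d + m) = v⁻¹ ^ d * qint m + v ^ m * qint d := by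
  unfold qint
  rw [pow_add, pow_add]
  ring

theorem qint_mul_inv_sub (d : ℕ) : (v⁻¹ - v) * qint d = v⁻¹ ^ d - v ^ d := by
  rw [qint, ← neg_sub v, neg_mul, mul_div_cancel₀ _ v_sub_inv_ne_zero, neg_sub]

theorem qfact_ne_zero (k : ℕ) : qfact k ≠ 0 := by
  induction k with
  | zero => exact one_ne_zero
  | succ k ih => exact mul_ne_zero (qint_ne_zero k.succ_ne_zero) ih

theorem qint_mul_inv_qfact_succ (k : ℕ) :
    qint (k + 1) * (qfact (k + 1))⁻¹ = (qfact k)⁻¹ := by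
  have h := qint_ne_zero k.succ_ne_zero
  rw [qfact, mul_inv, mul_inv_cancel_left₀ h]

theorem bar_qfact (bar : K →ₐ[ℚ] K) (hbar : bar v = v⁻¹) (k : ℕ) :
    bar (qfact k) = qfact k := by
  induction k with
  | zero => exact map_one bar
  | succ k ih =>
    rw [qfact, map_mul, ih]
    congr 1
    rw [qint, map_div₀, map_sub, map_sub, map_pow, map_pow, map_inv₀, hbar, inv_inv,
      ← neg_sub, ← neg_sub v, neg_div_neg_eq]

/-- The coefficient of `a ^ d * f ^ m * b ^ d` in the `(d + m)`-th divided power of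
`f + (v⁻¹ - v) • (a * b)`, where `f = b * a - v⁻¹ • (a * b)` is a root vector. -/
def barCoeff (d m : ℕ) : K :=
  v⁻¹ ^ d.choose 2 * (v⁻¹ - v) ^ d * (qfact d)⁻¹ * (qfact m)⁻¹

theorem qint_mul_barCoeff_succ_right (d m : ℕ) :
    qint (m + 1) * barCoeff d (m + 1) = barCoeff d m := by
  rw [barCoeff, barCoeff, ← qint_mul_inv_qfact_succ m]
  ring

theorem qint_mul_barCoeff_succ_left (d m : ℕ) :
    qint (d + 1) * barCoeff (d + 1) m = v⁻¹ ^ d * (v⁻¹ - v) * barCoeff d m := by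
  rw [barCoeff, barCoeff, ← qint_mul_inv_qfact_succ d, Nat.choose_succ_succ' d 1,
    Nat.choose_one_right]
  ring

section RootVector

variable {A : Type*} [Ring A] [Algebra K A] {a b f : A}

theorem mul_sub_smul_eq_root_add (hba : b * a = f + v⁻¹ • (a * b)) :
    b * a - v • (a * b) = f + (v⁻¹ - v) • (a * b) := by
  rw [hba, sub_smul, add_sub_assoc]

theorem mul_pow_of_eq_add_smul (hba : b * a = f + v⁻¹ • (a * b)) (hfa : f * a = v • (a * f))
    (d : ℕ) :
    b * a ^ (d + 1) = qint (d + 1) • (a ^ d * f) + v⁻¹ ^ (d + 1) • (a ^ (d + 1) * b) := by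
  induction d with
  | zero => simp [qint_one, hba]
  | succ d ih =>
    have h1 : qint (d + 1 + 1) = v * qint (d + 1) + v⁻¹ ^ (d + 1) := by
      rw [qint_add, qint_one]
      ring
    rw [pow_succ a (d + 1), ← mul_assoc, ih, add_mul, smul_mul_assoc, smul_mul_assoc,
      mul_assoc _ f a, hfa, mul_assoc _ b a, hba, mul_smul_comm, mul_add, smul_add, mul_smul_comm,
      h1, add_smul, smul_smul, smul_smul, ← mul_assoc, ← mul_assoc, ← pow_succ, mul_comm v,
      ← pow_succ, ← add_assoc]

theorem mul_pow_of_mul_eq_smul (hbf : b * f = v • (f * b)) (m : ℕ) :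
    b * f ^ m = v ^ m • (f ^ m * b) := by
  induction m with
  | zero => simp
  | succ m ih =>
    rw [pow_succ f, ← mul_assoc, ih, smul_mul_assoc, mul_assoc _ b f, hbf, mul_smul_comm,
      smul_smul, ← pow_succ, mul_assoc]

theorem root_mul_monomial (hba : b * a = f + v⁻¹ • (a * b)) (hfa : f * a = v • (a * f))
    (hbf : b * f = v • (f * b)) (d m : ℕ) :
    (f + (v⁻¹ - v) • (a * b)) * (a ^ d * f ^ m * b ^ d) =
      v⁻¹ ^ d • (a ^ d * f ^ (m + 1) * b ^ d) +
        ((v⁻¹ - v) * (v⁻¹ ^ d * v ^ m)) • (a ^ (d + 1) * f ^ m * b ^ (d + 1)) := by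
  have hf : f * (a ^ d * f ^ m * b ^ d) = v ^ d • (a ^ d * f ^ (m + 1) * b ^ d) := by
    rw [mul_assoc (a ^ d), ← mul_assoc f, mul_pow_of_mul_eq_smul hfa, smul_mul_assoc, pow_succ']
    simp only [mul_assoc]
  have hb : a * b * (a ^ d * f ^ m * b ^ d) = qint d • (a ^ d * f ^ (m + 1) * b ^ d) +
      (v⁻¹ ^ d * v ^ m) • (a ^ (d + 1) * f ^ m * b ^ (d + 1)) := by
    have h : a * b * a ^ d = qint d • (a ^ d * f) + v⁻¹ ^ d • (a ^ (d + 1) * b) := by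
      cases d with
      | zero => simp [qint_zero]
      | succ d =>
        rw [mul_assoc, mul_pow_of_eq_add_smul hba hfa, mul_add, mul_smul_comm, mul_smul_comm,
          ← mul_assoc, ← mul_assoc, ← pow_succ', ← pow_succ']
    rw [mul_assoc (a ^ d), ← mul_assoc (a * b), h, add_mul, smul_mul_assoc, smul_mul_assoc,
      ← mul_assoc (a ^ (d + 1) * b), mul_assoc _ b, mul_pow_of_mul_eq_smul hbf, mul_smul_comm,
      smul_mul_assoc, smul_smul, pow_succ' f, pow_succ' b]
    simp only [mul_assoc]
  rw [add_mul, smul_mul_assoc, hf, hb, smul_add, smul_smul, smul_smul, ← add_assoc, ← add_smul,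
    qint_mul_inv_sub, add_sub_cancel]

theorem root_pow (hba : b * a = f + v⁻¹ • (a * b)) (hfa : f * a = v • (a * f))
    (hbf : b * f = v • (f * b)) (r : ℕ) :
    (f + (v⁻¹ - v) • (a * b)) ^ r =
      qfact r • ∑ p ∈ Finset.HasAntidiagonal.antidiagonal r, barCoeff p.1 p.2 • (a ^ p.1 * f ^ p.2 * b ^ p.1) := by
  induction r with
  | zero => simp [barCoeff, qfact]
  | succ r ih =>
    have hsplit : qint (r + 1) • ∑ p ∈ Finset.HasAntidiagonal.antidiagonal (r + 1),
          barCoeff p.1 p.2 • (a ^ p.1 * f ^ p.2 * b ^ p.1) =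
        ∑ p ∈ Finset.HasAntidiagonal.antidiagonal (r + 1),
            (v⁻¹ ^ p.1 * (qint p.2 * barCoeff p.1 p.2)) • (a ^ p.1 * f ^ p.2 * b ^ p.1) +
          ∑ p ∈ Finset.HasAntidiagonal.antidiagonal (r + 1),
            (v ^ p.2 * (qint p.1 * barCoeff p.1 p.2)) • (a ^ p.1 * f ^ p.2 * b ^ p.1) := by
      rw [Finset.smul_sum, ← Finset.sum_add_distrib]
      refine Finset.sum_congr rfl fun p hp => ?_
      rw [smul_smul, ← add_smul, ← Finset.HasAntidiagonal.mem_antidiagonal.mp hp, qint_add]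
      congr 1
      ring
    rw [pow_succ', ih, mul_smul_comm, qfact, mul_comm (qint _), mul_smul, hsplit,
      Finset.Nat.sum_antidiagonal_succ', Finset.Nat.sum_antidiagonal_succ, qint_zero]
    simp only [zero_mul, mul_zero, zero_smul, zero_add]
    rw [← Finset.sum_add_distrib, Finset.mul_sum]
    congr 1
    refine Finset.sum_congr rfl fun p _ => ?_
    rw [mul_smul_comm, root_mul_monomial hba hfa hbf, qint_mul_barCoeff_succ_right,
      qint_mul_barCoeff_succ_left, smul_add, smul_smul, smul_smul]
    congr 2 <;> ring

end RootVector

theorem list_range_map_eq_ofFn {α : Type*} (N : ℕ) (g : ℕ → α) :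
    (List.range N).map g = List.ofFn fun i : Fin N => g i :=
  List.ext_getElem (by simp) (by simp)

theorem prod_range_sum {A : Type*} [Ring A] [Algebra K A] (N : ℕ) (s : ℕ → Finset ℕ)
    (g : ℕ → ℕ → A) :
    ((List.range N).map fun k => ∑ j ∈ s k, g k j).prod =
      ∑ y ∈ Fintype.piFinset fun i : Fin N => s i, (List.ofFn fun i : Fin N => g i (y i)).prod := by
  rw [list_range_map_eq_ofFn]
  simpa using (MultilinearMap.mkPiAlgebraFin K N A).map_sum_finset
    (fun i j => g i j) fun i => s i

theorem prod_Icc_one_eq_prod_range (m : ℕ) (g : ℕ → K) :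
    ∏ k ∈ Finset.Icc 1 m, g k = ∏ k ∈ Finset.range m, g (k + 1) := by
  induction m with
  | zero => simp
  | succ m ih => rw [Finset.prod_Icc_succ_top (by omega), ih, Finset.prod_range_succ]

section Uq

variable {n : ℕ}

theorem E_serre {i j : ℕ} (hi : 1 ≤ i) (hin : i ≤ n) (hj : 1 ≤ j) (hjn : j ≤ n)
    (hij : i + 1 = j ∨ j + 1 = i) :
    E n i ^ 2 * E n j + E n j * E n i ^ 2 = (v + v⁻¹) • (E n i * E n j * E n i) := by
  have hi' : i - 1 < n ∧ 1 ≤ i := by omega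
  have hj' : j - 1 < n ∧ 1 ≤ j := by omega
  have h := RingQuot.mkAlgHom_rel K
    (SerreRel.serre (n := n) ⟨i - 1, hi'.1⟩ ⟨j - 1, hj'.1⟩ (by simp only; omega))
  simpa only [E, dif_pos hi', dif_pos hj', map_add, map_mul, map_pow, map_smul] using h

theorem E_succ_mul_E (k : ℕ) :
    E n (k + 1) * E n k = Ebr n k + v⁻¹ • (E n k * E n (k + 1)) := by
  rw [Ebr, sub_add_cancel]

theorem Ebr_mul_E {k : ℕ} (hk : 1 ≤ k) (hkn : k < n) :
    Ebr n k * E n k = v • (E n k * Ebr n k) := by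
  have h := E_serre hk hkn.le (Nat.le_add_left 1 k) hkn (Or.inl rfl)
  simp only [Ebr, sub_mul, mul_sub, smul_sub, smul_mul_assoc, mul_smul_comm, smul_smul,
    mul_inv_cancel₀ v_ne_zero, one_smul, add_smul, ← mul_assoc, pow_two] at h ⊢
  rw [← eq_sub_iff_add_eq'] at h
  rw [h]
  abel

theorem E_succ_mul_Ebr {k : ℕ} (hk : 1 ≤ k) (hkn : k < n) :
    E n (k + 1) * Ebr n k = v • (Ebr n k * E n (k + 1)) := by
  have h := E_serre (Nat.le_add_left 1 k) hkn hk hkn.le (Or.inr rfl)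
  simp only [Ebr, sub_mul, mul_sub, smul_sub, smul_mul_assoc, mul_smul_comm, smul_smul,
    mul_inv_cancel₀ v_ne_zero, one_smul, add_smul, ← mul_assoc, pow_two] at h ⊢
  rw [← eq_sub_iff_add_eq] at h
  rw [h]
  abel

theorem dp_zero (u : Uq n) : dp n u 0 = 1 := by
  simp [dp, qfact]

/-- Divided powers of the same element multiply up to a quantum trinomial coefficient. -/
theorem dp_mul_dp_mul_dp (u : Uq n) (a c d : ℕ) :
    dp n u c * dp n u a * dp n u d =
      (qbinom (a + d + c) d * qbinom (a + c) c) • dp n u (a + d + c) := by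
  simp only [dp, smul_mul_smul_comm, smul_smul, ← pow_add]
  congr 1
  · rw [qbinom, qbinom, show a + d + c - d = a + c by omega, Nat.add_sub_cancel]
    have h1 := qfact_ne_zero a
    have h2 := qfact_ne_zero c
    have h3 := qfact_ne_zero d
    have h4 := qfact_ne_zero (a + c)
    have h5 := qfact_ne_zero (a + d + c)
    field_simp
  · congr 1
    omega

/-- The coefficient of `dp a d * dp f m * dp b d` in the `(d + m)`-th divided power of
`f + (v⁻¹ - v) • (a * b)`, where `f = b * a - v⁻¹ • (a * b)` is a root vector. -/
def dpCoeff (d : ℕ) : K := v⁻¹ ^ d.choose 2 * (v⁻¹ - v) ^ d * qfact d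

theorem dp_root {a b f : Uq n} (hba : b * a = f + v⁻¹ • (a * b)) (hfa : f * a = v • (a * f))
    (hbf : b * f = v • (f * b)) (r : ℕ) :
    dp n (f + (v⁻¹ - v) • (a * b)) r =
      ∑ m ∈ Finset.range (r + 1),
        dpCoeff (r - m) • (dp n a (r - m) * dp n f m * dp n b (r - m)) := by
  rw [dp, root_pow hba hfa hbf, smul_smul, inv_mul_cancel₀ (qfact_ne_zero r), one_smul,
    ← Finset.Nat.sum_antidiagonal_swap, Finset.Nat.sum_antidiagonal_eq_sum_range_succ_mk]
  refine Finset.sum_congr rfl fun m _ => ?_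
  simp only [Prod.swap, dp, smul_mul_smul_comm, smul_smul]
  congr 1
  rw [barCoeff, dpCoeff]
  have h := qfact_ne_zero (r - m)
  field_simp

section Bar

variable {bar : K →ₐ[ℚ] K} {σ : Uq n →+* Uq n}

theorem map_smul_of_map_algebraMap
    (hσc : ∀ c : K, σ (algebraMap K (Uq n) c) = algebraMap K (Uq n) (bar c)) (c : K) (u : Uq n) :
    σ (c • u) = bar c • σ u := by
  rw [Algebra.smul_def, map_mul, hσc, ← Algebra.smul_def]

theorem map_dp (hbar : bar v = v⁻¹)
    (hσc : ∀ c : K, σ (algebraMap K (Uq n) c) = algebraMap K (Uq n) (bar c)) (u : Uq n) (r : ℕ) :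
    σ (dp n u r) = dp n (σ u) r := by
  rw [dp, dp, map_smul_of_map_algebraMap hσc, map_inv₀, bar_qfact bar hbar, map_pow]

theorem map_Ebr (hbar : bar v = v⁻¹) (hσE : ∀ j : ℕ, 1 ≤ j → j ≤ n → σ (E n j) = E n j)
    (hσc : ∀ c : K, σ (algebraMap K (Uq n) c) = algebraMap K (Uq n) (bar c))
    {k : ℕ} (hk : 1 ≤ k) (hkn : k < n) :
    σ (Ebr n k) = Ebr n k + (v⁻¹ - v) • (E n k * E n (k + 1)) := by
  rw [Ebr, map_sub, map_smul_of_map_algebraMap hσc, map_mul, map_mul, hσE k hk hkn.le,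
    hσE (k + 1) (by omega) hkn, map_inv₀, hbar, inv_inv]
  exact mul_sub_smul_eq_root_add (E_succ_mul_E k)

end Bar

/-- The `j`-th term in the expansion of the image of the `k`-th factor of `E(x')` under the
bar involution. -/
def barTerm (n : ℕ) (x : ℕ → ℕ) (k j : ℕ) : Uq n :=
  dpCoeff (x k - j) • (dp n (E n k) (n + 1 - x (k - 1) - x k) *
    (dp n (E n k) (x k - j) * dp n (Ebr n k) j * dp n (E n (k + 1)) (x k - j)))

theorem prod_barTerm {x y : ℕ → ℕ} (hx0 : x 0 = 0) (hyx : ∀ k, y k ≤ x k) (m : ℕ)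
    (hx : ∀ k < m, x k + x (k + 1) ≤ n + 1) :
    ((List.range m).map fun k => barTerm n x (k + 1) (y (k + 1))).prod =
      (∏ k ∈ Finset.range m, (dpCoeff (x (k + 1) - y (k + 1)) *
        (qbinom ((n + 1 - x k - x (k + 1)) + (x (k + 1) - y (k + 1)) + (x k - y k))
            (x (k + 1) - y (k + 1)) *
          qbinom ((n + 1 - x k - x (k + 1)) + (x k - y k)) (x k - y k)))) •
      (((List.range m).map fun k => dp n (E n (k + 1)) (n + 1 - y k - y (k + 1)) *
          dp n (Ebr n (k + 1)) (y (k + 1))).prod *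
        dp n (E n (m + 1)) (x m - y m)) := by
  induction m with
  | zero => simp [hx0, dp_zero]
  | succ m ih =>
    have hsum : n + 1 - y m - y (m + 1) =
        (n + 1 - x m - x (m + 1)) + (x (m + 1) - y (m + 1)) + (x m - y m) := by
      have := hx m (Nat.lt_succ_self m)
      have := hyx m
      have := hyx (m + 1)
      omega
    have hdp := dp_mul_dp_mul_dp (E n (m + 1)) (n + 1 - x m - x (m + 1)) (x m - y m)
      (x (m + 1) - y (m + 1))
    rw [List.range_succ, List.map_append, List.map_append, List.prod_append, List.prod_append,
      ih fun k hk => hx k (by omega), Finset.prod_range_succ, List.map_singleton,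
      List.map_singleton, List.prod_singleton, List.prod_singleton, barTerm, Nat.add_sub_cancel,
      smul_mul_smul_comm, hsum]
    generalize dp n (E n (m + 1)) (x (m + 1) - y (m + 1)) = D at hdp ⊢
    generalize dp n (E n (m + 1)) (n + 1 - x m - x (m + 1)) = B at hdp ⊢
    rw [mul_assoc _ _ (B * _), ← mul_assoc _ B, ← mul_assoc (_ * B), ← mul_assoc (_ * B) D, hdp,
      smul_mul_assoc, smul_mul_assoc, mul_smul_comm, smul_smul, mul_assoc (∏ _ ∈ _, _),
      ← mul_assoc (List.prod _)]

theorem map_factor {bar : K →ₐ[ℚ] K} {σ : Uq n →+* Uq n} (hbar : bar v = v⁻¹)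
    (hσE : ∀ j : ℕ, 1 ≤ j → j ≤ n → σ (E n j) = E n j)
    (hσc : ∀ c : K, σ (algebraMap K (Uq n) c) = algebraMap K (Uq n) (bar c))
    (x : ℕ → ℕ) {k : ℕ} (hk : 1 ≤ k) (hkn : k < n) :
    σ (dp n (E n k) (n + 1 - x (k - 1) - x k) * dp n (Ebr n k) (x k)) =
      ∑ j ∈ Finset.range (x k + 1), barTerm n x k j := by
  rw [map_mul, map_dp hbar hσc, map_dp hbar hσc, map_Ebr hbar hσE hσc hk hkn, hσE k hk hkn.le,
    dp_root (E_succ_mul_E k) (Ebr_mul_E hk hkn) (E_succ_mul_Ebr hk hkn), Finset.mul_sum]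
  exact Finset.sum_congr rfl fun j _ => mul_smul_comm _ _ _

theorem prod_dpCoeff (s : Finset ℕ) (d : ℕ → ℕ) :
    ∏ k ∈ s, dpCoeff (d k) =
      v ^ (-((∑ k ∈ s, d k * (d k - 1) / 2 : ℕ) : ℤ)) * (v⁻¹ - v) ^ (∑ k ∈ s, d k) *
        ∏ k ∈ s, qfact (d k) := by
  simp only [dpCoeff, Finset.prod_mul_distrib, Finset.prod_pow_eq_pow_sum, Nat.choose_two_right,
    zpow_neg, zpow_natCast, inv_pow, Finset.prod_inv_distrib]

theorem list_range_prod_eq {A : Type*} [Monoid A] (hn : 1 ≤ n) (g : ℕ → A) :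
    ((List.range n).map g).prod = ((List.range (n - 1)).map g).prod * g (n - 1) := by
  obtain ⟨m, rfl⟩ := Nat.exists_eq_add_of_le' hn
  simp [List.range_succ]

theorem tup_succ (y : Fin (n - 1) → ℕ) (i : Fin (n - 1)) : tup n y (i + 1) = y i :=
  dif_pos ⟨i.2, Nat.le_add_left 1 i⟩

theorem tup_zero (y : Fin (n - 1) → ℕ) : tup n y 0 = 0 :=
  dif_neg (by omega)

theorem tup_self (y : Fin (n - 1) → ℕ) : tup n y n = 0 :=
  dif_neg (by omega)

theorem tup_le {x : ℕ → ℕ} {y : Fin (n - 1) → ℕ} (hy : ∀ i : Fin (n - 1), y i ≤ x (i + 1))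
    (k : ℕ) : tup n y k ≤ x k := by
  unfold tup
  split_ifs with h
  · simpa [Nat.sub_add_cancel h.2] using hy ⟨k - 1, h.1⟩
  · exact Nat.zero_le _

end Uq

/-- the bar involution applied to the PBW monomial `E(x')`, for a
tuple `x` with `x_k ≤ min(k, n-k)`, expands as `σ(E(x')) = Σ_{y ≤ x} w_y E(y')`,
with the explicit coefficients `w_y` of Lemma 6.2 of the paper (writing
`d_k = x_k - y_k` and `a_k = n + 1 - x_{k-1} - x_k`). -/
theorem stmt19 (n : ℕ) (hn : 1 ≤ n)
    (bar : K →ₐ[ℚ] K) (hbar : bar v = v⁻¹)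
    (σ : Uq n →+* Uq n)
    (hσE : ∀ j : ℕ, 1 ≤ j → j ≤ n → σ (E n j) = E n j)
    (hσc : ∀ c : K, σ (algebraMap K (Uq n) c) = algebraMap K (Uq n) (bar c))
    (x : ℕ → ℕ) (hx0 : x 0 = 0) (hxn : x n = 0)
    (hxb : ∀ k : ℕ, 1 ≤ k → k ≤ n - 1 → x k ≤ min k (n - k)) :
    σ (Eprod n (fun k =>
        dp n (E n k) (n + 1 - x (k - 1) - x k) * dp n (Ebr n k) (x k))) =
    ∑ y ∈ Fintype.piFinset
        (fun i : Fin (n - 1) => Finset.range (x ((i : ℕ) + 1) + 1)),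
      (v ^ (-((∑ k ∈ Finset.Icc 1 (n - 1),
              (x k - tup n y k) * (x k - tup n y k - 1) / 2 : ℕ) : ℤ)) *
        (v⁻¹ - v) ^ (∑ k ∈ Finset.Icc 1 (n - 1), (x k - tup n y k)) *
        (∏ k ∈ Finset.Icc 1 (n - 1), qfact (x k - tup n y k)) *
        ∏ k ∈ Finset.Icc 1 n,
          qbinom ((n + 1 - x (k - 1) - x k) + (x k - tup n y k) + (x (k - 1) - tup n y (k - 1)))
              (x k - tup n y k) *
            qbinom ((n + 1 - x (k - 1) - x k) + (x (k - 1) - tup n y (k - 1)))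
              (x (k - 1) - tup n y (k - 1))) •
      Eprod n (fun k =>
        dp n (E n k) (n + 1 - tup n y (k - 1) - tup n y k) * dp n (Ebr n k) (tup n y k)) := by
  have hx : ∀ k < n, x k + x (k + 1) ≤ n + 1 := by
    intro k hk
    have h1 : x k ≤ k := by
      rcases Nat.eq_zero_or_pos k with rfl | h
      · exact hx0.le
      · exact (hxb k h (by omega)).trans (min_le_left _ _)
    have h2 : x (k + 1) ≤ n - (k + 1) := by
      rcases eq_or_ne (k + 1) n with h | h
      · simp [h, hxn]
      · exact (hxb (k + 1) (by omega) (by omega)).trans (min_le_right _ _)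
    omega
  have hlhs : σ (Eprod n fun k =>
        dp n (E n k) (n + 1 - x (k - 1) - x k) * dp n (Ebr n k) (x k)) =
      ((List.range (n - 1)).map fun k =>
        ∑ j ∈ Finset.range (x (k + 1) + 1), barTerm n x (k + 1) j).prod * barTerm n x n 0 := by
    rw [Eprod, map_list_prod, List.map_map, list_range_prod_eq hn]
    congr 1
    · congr 1
      refine List.map_congr_left fun k hk => ?_
      have := List.mem_range.mp hk
      exact map_factor hbar hσE hσc x (Nat.le_add_left 1 k) (by omega)
    · simp only [Function.comp_apply, Nat.sub_add_cancel hn]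
      rw [map_mul, map_dp hbar hσc, hσE n hn le_rfl]
      simp [barTerm, hxn, dp_zero, dpCoeff, qfact]
  rw [hlhs, prod_range_sum, Finset.sum_mul]
  refine Finset.sum_congr rfl fun y hy => ?_
  have hyx : ∀ k, tup n y k ≤ x k := tup_le fun i =>
    Nat.lt_succ_iff.mp (Finset.mem_range.mp (Fintype.mem_piFinset.mp hy i))
  have hprod : (List.ofFn fun i : Fin (n - 1) => barTerm n x (i + 1) (y i)).prod *
        barTerm n x n 0 =
      ((List.range n).map fun k => barTerm n x (k + 1) (tup n y (k + 1))).prod := by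
    rw [list_range_prod_eq hn, list_range_map_eq_ofFn, Nat.sub_add_cancel hn, tup_self]
    simp only [tup_succ]
  rw [hprod, prod_barTerm hx0 hyx n hx, hxn, Nat.zero_sub, dp_zero, mul_one, Eprod,
    ← prod_dpCoeff, prod_Icc_one_eq_prod_range, prod_Icc_one_eq_prod_range,
    Finset.prod_mul_distrib]
  congr 2
  obtain ⟨m, rfl⟩ := Nat.exists_eq_add_of_le' hn
  simp [Finset.prod_range_succ, hxn, dpCoeff, qfact]

end
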